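/- Let α and β be types, let Φ be an atoroidal automorphism of FreeGroup α and Ψ an atoroidal automorphism of FreeGroup β. Let Θ be the endomorphism of FreeGroup (α ⊕ β) determined on generators by Θ(of (Sum.inl a)) = FreeGroup.map Sum.inl (Φ (of a)) and Θ(of (Sum.inr b)) = FreeGroup.map Sum.inr (Ψ (of b)) (the free product automorphism Φ ∗ Ψ). Then Θ is an automorphism of FreeGroup (α ⊕ β) and Θ is atoroidal. -/

import Mathlib

/-- An automorphism `Φ` is atoroidal if no positive power of `Φ` maps a nontrivial
element to a conjugate of itself. -/
def MulAut.Atoroidal {G : Type*} [Group G] (Φ : MulAut G) : Prop :=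
  ∀ n : ℕ, 1 ≤ n → ∀ g : G, g ≠ 1 → ¬ IsConj ((Φ ^ n) g) g

/-- The free product `Φ ∗ Ψ` of endomorphisms, as an endomorphism of
`FreeGroup (α ⊕ β)`, determined on generators by `Φ` on the first factor and `Ψ`
on the second factor. -/
def freeProdEndo {α β : Type*} (Φ : MulAut (FreeGroup α)) (Ψ : MulAut (FreeGroup β)) :
    FreeGroup (α ⊕ β) →* FreeGroup (α ⊕ β) :=
  FreeGroup.lift (Sum.elim
    (fun a => FreeGroup.map Sum.inl (Φ (FreeGroup.of a)))
    (fun b => FreeGroup.map Sum.inr (Ψ (FreeGroup.of b))))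

namespace FPAtor

open Monoid Monoid.CoprodI

section
variable {ι : Type*} {G : ι → Type*} [∀ i, Group (G i)]

/-- reduced lists of syllables -/
def Red (L : List (Σ i, G i)) : Prop :=
  (∀ l ∈ L, l.2 ≠ 1) ∧ L.IsChain fun l l' => l.1 ≠ l'.1

/-- product of a list of syllables -/
def lprod (L : List (Σ i, G i)) : CoprodI G := (L.map fun l => of l.2).prod

open Classical in
/-- normal form -/
noncomputable def nf (g : CoprodI G) : List (Σ i, G i) := (Word.equiv g).toList

theorem nf_red (g : CoprodI G) : Red (nf g) := by
  classical exact ⟨(Word.equiv g).ne_one, (Word.equiv g).chain_ne⟩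

theorem lprod_nf (g : CoprodI G) : lprod (nf g) = g := by
  classical exact Word.equiv.symm_apply_apply g

theorem nf_lprod {L : List (Σ i, G i)} (h : Red L) : nf (lprod L) = L := by
  classical
  have := Word.equiv.apply_symm_apply (⟨L, h.1, h.2⟩ : Word G)
  exact congrArg Word.toList this

theorem lprod_append (L M : List (Σ i, G i)) : lprod (L ++ M) = lprod L * lprod M := by
  simp [lprod]

theorem lprod_cons (a : Σ i, G i) (M : List (Σ i, G i)) :
    lprod (a :: M) = of a.2 * lprod M := by
  simp [lprod]

theorem lprod_replicate (L : List (Σ i, G i)) (n : ℕ) :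
    lprod (List.replicate n L).flatten = lprod L ^ n := by
  induction n with
  | zero => simp [lprod]
  | succ n ih => rw [List.replicate_succ, List.flatten_cons, lprod_append, ih, pow_succ']

open Classical in
theorem count_of_mul (s : Σ i, G i) {i} (m : G i) (g : CoprodI G) :
    (nf (of m * g)).count s ≤ (nf g).count s + 1 := by
  have h1 : Word.equiv (of m * g) = of m • Word.equiv g := by
    change (of m * g) • (Word.empty : Word G) = of m • g • (Word.empty : Word G)
    rw [mul_smul]
  have h2 : Word.equiv g = Word.rcons (Word.equivPair i (Word.equiv g)) := by
    rw [← Word.equivPair_symm, Equiv.symm_apply_apply]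
  unfold nf
  rw [h1, Word.of_smul_def]
  generalize hp : Word.equivPair i (Word.equiv g) = p at *
  rw [h2]
  have key : ∀ q : Word.Pair G i, (q.tail.toList.count s ≤ (Word.rcons q).toList.count s) ∧
     (Word.rcons q).toList.count s ≤ q.tail.toList.count s + 1 := by
    intro q
    unfold Word.rcons
    split_ifs with h
    · simp
    · simp only [Word.cons_toList, List.count_cons]
      split_ifs <;> simp
  have k1 := key p
  have k2 := key ⟨m * p.head, p.tail, p.fstIdx_ne⟩
  dsimp only at k2 ⊢
  omega

open Classical in
theorem count_mul_left (s : Σ i, G i) (x : CoprodI G) :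
    ∃ C : ℕ, ∀ g, (nf (x * g)).count s ≤ (nf g).count s + C := by
  induction x using CoprodI.induction_on with
  | one => exact ⟨0, by simp⟩
  | of i m => exact ⟨1, fun g => count_of_mul s m g⟩
  | mul x y hx hy =>
    obtain ⟨C, hC⟩ := hx
    obtain ⟨D, hD⟩ := hy
    refine ⟨C + D, fun g => ?_⟩
    have := hC (y * g)
    have := hD g
    rw [mul_assoc]
    omega

/-- inverse of syllables -/
def sinv (s : Σ i, G i) : Σ i, G i := ⟨s.1, s.2⁻¹⟩

theorem sinv_inj : Function.Injective (sinv (G := G)) := by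
  have : Function.LeftInverse (sinv (G := G)) sinv := fun s => by
    obtain ⟨i, x⟩ := s; exact congrArg (Sigma.mk i) (inv_inv x)
  exact this.injective

theorem sinv_sinv (s : Σ i, G i) : sinv (sinv s) = s := by
  obtain ⟨i, x⟩ := s; exact congrArg (Sigma.mk i) (inv_inv x)

theorem lprod_inv (L : List (Σ i, G i)) : lprod (L.reverse.map sinv) = (lprod L)⁻¹ := by
  induction L with
  | nil => simp [lprod]
  | cons a L ih =>
    rw [List.reverse_cons, List.map_append, lprod_append, ih, lprod_cons, mul_inv_rev]
    simp [lprod, sinv]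

theorem nf_inv (g : CoprodI G) : nf g⁻¹ = (nf g).reverse.map sinv := by
  conv_lhs => rw [← lprod_nf g, ← lprod_inv]
  apply nf_lprod
  refine ⟨?_, ?_⟩
  · intro l hl
    simp only [List.mem_map, List.mem_reverse] at hl
    obtain ⟨a, ha, rfl⟩ := hl
    exact inv_ne_one.2 ((nf_red g).1 a ha)
  · rw [List.isChain_map, List.isChain_reverse]
    exact (nf_red g).2.imp fun a b h => h.symm

open Classical in
theorem count_inv (s : Σ i, G i) (g : CoprodI G) :
    (nf g⁻¹).count s = (nf g).count (sinv s) := by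
  rw [nf_inv, ← sinv_sinv s, List.count_map_of_injective _ _ sinv_inj, List.count_reverse,
    sinv_sinv]

open Classical in
theorem count_mul_right (s : Σ i, G i) (x : CoprodI G) :
    ∃ C : ℕ, ∀ g, (nf (g * x)).count s ≤ (nf g).count s + C := by
  obtain ⟨C, hC⟩ := count_mul_left (sinv s) x⁻¹
  refine ⟨C, fun g => ?_⟩
  have := hC g⁻¹
  rwa [← mul_inv_rev, ← count_inv, inv_inv, ← count_inv, inv_inv] at this

/-- cyclically reduced -/
def CRed (L : List (Σ i, G i)) : Prop :=
  Red L ∧ L ≠ [] ∧ ∀ a ∈ L.getLast?, ∀ b ∈ L.head?, a.1 ≠ b.1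

theorem CRed.replicate {L : List (Σ i, G i)} (h : CRed L) (n : ℕ) :
    Red (List.replicate n L).flatten := by
  refine ⟨?_, ?_⟩
  · intro l hl
    simp only [List.mem_flatten, List.mem_replicate] at hl
    obtain ⟨_, ⟨_, rfl⟩, hl⟩ := hl
    exact h.1.1 l hl
  · rw [List.isChain_flatten (by
      intro h'
      exact h.2.1 (List.mem_replicate.1 h').2.symm)]
    refine ⟨?_, List.isChain_replicate_of_rel _ h.2.2⟩
    intro l hl
    rw [(List.mem_replicate.1 hl).2]
    exact h.1.2

theorem exists_cred (n : ℕ) : ∀ L : List (Σ i, G i), L.length ≤ n → Red L → L ≠ [] →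
    (∃ i, ∃ m : G i, m ≠ 1 ∧ IsConj (lprod L) (of m)) ∨
    (∃ M, CRed M ∧ IsConj (lprod L) (lprod M)) := by
  induction n with
  | zero => intro L h _ h'; simp at h; contradiction
  | succ n ih =>
    intro L hlen hL hne
    induction L using List.bidirectionalRec with
    | nil => contradiction
    | singleton a =>
      left
      exact ⟨a.1, a.2, hL.1 a (by simp), by
        have : lprod [a] = of a.2 := by simp [lprod]
        rw [this]⟩
    | cons_append a M b _ =>
      clear * - ih hlen hL
      by_cases hab : b.1 = a.1
      · obtain ⟨i, x⟩ := a
        obtain ⟨j, y⟩ := b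
        dsimp only at hab
        subst hab
        have hM : M ≠ [] := by
          rintro rfl
          have := hL.2
          simp at this
        have hMr : Red M := ⟨fun l hl => hL.1 l (by simp [hl]),
          (List.isChain_append.1 hL.2.tail).1⟩
        have hc : IsConj (lprod (⟨j, x⟩ :: (M ++ [⟨j, y⟩]))) (lprod M * of (y * x)) := by
          rw [lprod_cons, lprod_append]
          rw [isConj_iff]
          refine ⟨(of x)⁻¹, ?_⟩
          simp [lprod, mul_assoc]
        simp only [List.length_cons, List.length_append, List.length_nil] at hlen
        by_cases hyx : y * x = 1
        · rw [hyx, map_one, mul_one] at hc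
          rcases ih M (by omega) hMr hM with ⟨i, m, hm, h⟩ | ⟨N, hN, h⟩
          · exact Or.inl ⟨i, m, hm, hc.trans h⟩
          · exact Or.inr ⟨N, hN, hc.trans h⟩
        · have hc' : IsConj (lprod (⟨j, x⟩ :: (M ++ [⟨j, y⟩]))) (lprod (M ++ [⟨j, y * x⟩])) := by
            rw [lprod_append]
            simpa [lprod] using hc
          have hr : Red (M ++ [(⟨j, y * x⟩ : Σ i, G i)]) := by
            refine ⟨?_, ?_⟩
            · intro l hl
              simp only [List.mem_append, List.mem_singleton] at hl
              rcases hl with hl | rfl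
              · exact hMr.1 l hl
              · exact hyx
            · have := hL.2.tail
              simp only [List.tail_cons, List.isChain_append] at this ⊢
              refine ⟨this.1, by simp, ?_⟩
              intro u hu v hv
              simp at hv
              subst hv
              exact this.2.2 u hu ⟨j, y⟩ (by simp)
          rcases ih _ (by simp; omega) hr (by simp) with ⟨i, m, hm, h⟩ | ⟨N, hN, h⟩
          · exact Or.inl ⟨i, m, hm, hc'.trans h⟩
          · exact Or.inr ⟨N, hN, hc'.trans h⟩
      · right
        refine ⟨_, ⟨hL, by simp, ?_⟩, IsConj.refl _⟩
        intro u hu v hv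
        rw [← List.cons_append, List.getLast?_concat] at hu
        simp at hu hv
        subst hu hv
        exact hab

open Classical in
theorem mem_of_conj {L M : List (Σ i, G i)} (hL : CRed L) (hM : CRed M)
    (h : IsConj (lprod L) (lprod M)) : ∀ s ∈ M, s ∈ L := by
  intro s hs
  by_contra hsL
  obtain ⟨x, hx⟩ := isConj_iff.1 h
  obtain ⟨C, hC⟩ := count_mul_left s x
  obtain ⟨D, hD⟩ := count_mul_right s x⁻¹
  have h1 := hC (lprod L ^ (C + D + 1))
  have h2 := hD (x * lprod L ^ (C + D + 1))
  rw [← conj_pow, hx, ← lprod_replicate, nf_lprod (hM.replicate _)] at h2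
  rw [← lprod_replicate, nf_lprod (hL.replicate _)] at h1
  rw [← lprod_replicate] at h2
  rw [List.count_flatten, List.map_replicate, List.sum_replicate] at h2
  have h3 : 0 < M.count s := List.count_pos_iff.2 hs
  have h4 : L.count s = 0 := List.count_eq_zero.2 hsL
  rw [List.count_flatten, List.map_replicate, List.sum_replicate, h4] at h1
  simp only [smul_eq_mul, mul_zero] at h1 h2
  nlinarith

theorem main (φ : ∀ i, G i →* G i) (hφ : ∀ i, Function.Injective (φ i))
    (h : ∀ i (k : ℕ), 1 ≤ k → ∀ x : G i, x ≠ 1 → ¬ IsConj ((φ i)^[k] x) x)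
    (g : CoprodI G) (hg : g ≠ 1) :
    ¬ IsConj (CoprodI.lift (fun i => (of : G i →* CoprodI G).comp (φ i)) g) g := by
  classical
  set Θ := CoprodI.lift (fun i => (of : G i →* CoprodI G).comp (φ i)) with hΘ
  intro hc
  have hne : nf g ≠ [] := by
    intro h0
    apply hg
    rw [← lprod_nf g, h0]
    rfl
  rcases exists_cred _ (nf g) le_rfl (nf_red g) hne with ⟨i, m, hm, hcm⟩ | ⟨M, hM, hcm⟩
  · rw [lprod_nf] at hcm
    have h1 : IsConj (of (φ i m)) (of m : CoprodI G) := by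
      have := Θ.map_isConj hcm
      rw [hΘ, lift_of] at this
      exact this.symm.trans (hc.trans hcm)
    have h2 := (CoprodI.lift (Pi.mulSingle i (MonoidHom.id (G i)))).map_isConj h1
    rw [of_leftInverse, of_leftInverse] at h2
    exact h i 1 le_rfl m hm h2
  · rw [lprod_nf] at hcm
    let f : (Σ i, G i) → (Σ i, G i) := fun s => ⟨s.1, φ s.1 s.2⟩
    have hlp : Θ (lprod M) = lprod (M.map f) := by
      simp only [lprod, map_list_prod, List.map_map]
      congr 1
    have hMf : CRed (M.map f) := by
      refine ⟨⟨?_, ?_⟩, ?_, ?_⟩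
      · intro l hl
        obtain ⟨a, ha, rfl⟩ := List.mem_map.1 hl
        exact fun h0 => hM.1.1 a ha ((map_eq_one_iff _ (hφ a.1)).1 h0)
      · rw [List.isChain_map]
        exact hM.1.2
      · simpa using hM.2.1
      · intro a ha b hb
        simp only [List.getLast?_map, List.head?_map, Option.mem_def, Option.map_eq_some_iff]
          at ha hb
        obtain ⟨a, ha, rfl⟩ := ha
        obtain ⟨b, hb, rfl⟩ := hb
        exact hM.2.2 a ha b hb
    have hcc : IsConj (lprod M) (lprod (M.map f)) := by
      have := Θ.map_isConj hcm
      rw [hlp] at this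
      exact (hcm.symm.trans hc.symm).trans this
    have hmem : ∀ s ∈ M, f s ∈ M := fun s hs =>
      mem_of_conj hM hMf hcc _ (List.mem_map_of_mem hs)
    obtain ⟨s, hs⟩ := List.exists_mem_of_ne_nil M hM.2.1
    have hit : ∀ k, f^[k] s = ⟨s.1, (φ s.1)^[k] s.2⟩ := by
      intro k
      induction k with
      | zero => rfl
      | succ k ih => rw [Function.iterate_succ_apply', ih, Function.iterate_succ_apply']
    have hin : ∀ k, f^[k] s ∈ M := by
      intro k
      induction k with
      | zero => exact hs
      | succ k ih => rw [Function.iterate_succ_apply']; exact hmem _ ih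
    obtain ⟨a, -, b, -, hab, he⟩ := Set.infinite_univ.exists_lt_map_eq_of_mapsTo
      (f := fun k : ℕ => f^[k] s) (t := {x | x ∈ M}) (fun k _ => hin k)
      (List.finite_toSet M)
    rw [hit, hit] at he
    have he2 : (φ s.1)^[a] s.2 = (φ s.1)^[b] s.2 := by simpa using he
    obtain ⟨d, rfl⟩ := Nat.exists_eq_add_of_lt hab
    rw [add_assoc, Function.iterate_add_apply] at he2
    have he3 := (hφ s.1).iterate a he2
    refine h s.1 (d + 1) (by omega) s.2 (hM.1.1 s hs) ?_
    rw [← he3]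
end

section
universe u v
variable {α : Type u} {β : Type v}

/-- the two factors -/
abbrev Fam (α : Type u) (β : Type v) : Bool → Type (max u v)
  | true => ULift.{v} (FreeGroup α)
  | false => ULift.{u} (FreeGroup β)

instance (i : Bool) : Group (Fam α β i) :=
  match i with
  | true => inferInstanceAs (Group (ULift.{v} (FreeGroup α)))
  | false => inferInstanceAs (Group (ULift.{u} (FreeGroup β)))

/-- left factor -/
def eL : Fam α β true ≃* FreeGroup α := (MulEquiv.ulift : ULift.{v} (FreeGroup α) ≃* _)
/-- right factor -/
def eR : Fam α β false ≃* FreeGroup β := (MulEquiv.ulift : ULift.{u} (FreeGroup β) ≃* _)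

/-- components of the map back -/
def back : ∀ i : Bool, Fam α β i →* FreeGroup (α ⊕ β)
  | true => (FreeGroup.map Sum.inl).comp eL.toMonoidHom
  | false => (FreeGroup.map Sum.inr).comp eR.toMonoidHom

/-- to the coproduct -/
def toC : FreeGroup (α ⊕ β) →* CoprodI (Fam α β) :=
  FreeGroup.lift (Sum.elim (fun a => of (eL.symm (FreeGroup.of a)))
    (fun b => of (eR.symm (FreeGroup.of b))))

theorem toC_inl (x : FreeGroup α) :
    toC (β := β) (FreeGroup.map Sum.inl x) = of (eL.symm x) := by
  have : toC.comp (FreeGroup.map Sum.inl) =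
      (of : Fam α β true →* _).comp eL.symm.toMonoidHom := by
    ext a; simp [toC]
  exact DFunLike.congr_fun this x

theorem toC_inr (x : FreeGroup β) :
    toC (α := α) (FreeGroup.map Sum.inr x) = of (eR.symm x) := by
  have : toC.comp (FreeGroup.map Sum.inr) =
      (of : Fam α β false →* _).comp eR.symm.toMonoidHom := by
    ext a; simp [toC]
  exact DFunLike.congr_fun this x

theorem toC_inj : Function.Injective (toC (α := α) (β := β)) := by
  have : (CoprodI.lift back).comp toC = MonoidHom.id (FreeGroup (α ⊕ β)) := by
    ext a
    rcases a with a | a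
    · simp [toC, back]
    · simp [toC, back]
  exact Function.LeftInverse.injective (g := CoprodI.lift back) (DFunLike.congr_fun this)

/-- maps on factors -/
def phi (Φ : MulAut (FreeGroup α)) (Ψ : MulAut (FreeGroup β)) :
    ∀ i : Bool, Fam α β i →* Fam α β i
  | true => (eL.symm.toMonoidHom.comp Φ.toMonoidHom).comp eL.toMonoidHom
  | false => (eR.symm.toMonoidHom.comp Ψ.toMonoidHom).comp eR.toMonoidHom

theorem endo_inl (Φ : MulAut (FreeGroup α)) (Ψ : MulAut (FreeGroup β)) (x : FreeGroup α) :
    freeProdEndo Φ Ψ (FreeGroup.map Sum.inl x) = FreeGroup.map Sum.inl (Φ x) := by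
  have : (freeProdEndo Φ Ψ).comp (FreeGroup.map Sum.inl) =
      (FreeGroup.map Sum.inl).comp Φ.toMonoidHom := by
    ext a; simp [freeProdEndo]
  exact DFunLike.congr_fun this x

theorem endo_inr (Φ : MulAut (FreeGroup α)) (Ψ : MulAut (FreeGroup β)) (x : FreeGroup β) :
    freeProdEndo Φ Ψ (FreeGroup.map Sum.inr x) = FreeGroup.map Sum.inr (Ψ x) := by
  have : (freeProdEndo Φ Ψ).comp (FreeGroup.map Sum.inr) =
      (FreeGroup.map Sum.inr).comp Ψ.toMonoidHom := by
    ext a; simp [freeProdEndo]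
  exact DFunLike.congr_fun this x

theorem endo_mul (Φ Φ' : MulAut (FreeGroup α)) (Ψ Ψ' : MulAut (FreeGroup β)) :
    freeProdEndo (Φ * Φ') (Ψ * Ψ') = (freeProdEndo Φ Ψ).comp (freeProdEndo Φ' Ψ') := by
  ext a
  rcases a with a | a
  · have := endo_inl Φ Ψ (Φ' (FreeGroup.of a))
    simp only [MonoidHom.comp_apply]
    conv_rhs => rw [freeProdEndo.eq_1 Φ' Ψ']
    simp [this]
    simp [freeProdEndo]
  · have := endo_inr Φ Ψ (Ψ' (FreeGroup.of a))
    simp only [MonoidHom.comp_apply]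
    conv_rhs => rw [freeProdEndo.eq_1 Φ' Ψ']
    simp [this]
    simp [freeProdEndo]

theorem endo_one : freeProdEndo (1 : MulAut (FreeGroup α)) (1 : MulAut (FreeGroup β)) =
    MonoidHom.id _ := by
  ext a
  rcases a with a | a <;> simp [freeProdEndo]

theorem endo_pow (Φ : MulAut (FreeGroup α)) (Ψ : MulAut (FreeGroup β)) (n : ℕ)
    (x : FreeGroup (α ⊕ β)) :
    freeProdEndo (Φ ^ n) (Ψ ^ n) x = (freeProdEndo Φ Ψ)^[n] x := by
  induction n with
  | zero => simp [endo_one]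
  | succ n ih =>
    rw [pow_succ', pow_succ', endo_mul, Function.iterate_succ_apply', ← ih]
    rfl

theorem toC_endo (Φ : MulAut (FreeGroup α)) (Ψ : MulAut (FreeGroup β)) (x : FreeGroup (α ⊕ β)) :
    toC (freeProdEndo Φ Ψ x) =
      CoprodI.lift (fun i => (of : Fam α β i →* _).comp (phi Φ Ψ i)) (toC x) := by
  have : toC.comp (freeProdEndo Φ Ψ) =
      (CoprodI.lift (fun i => (of : Fam α β i →* _).comp (phi Φ Ψ i))).comp toC := by
    ext a
    rcases a with a | a
    · have h1 := toC_inl (β := β) (Φ (FreeGroup.of a))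
      simp [freeProdEndo, h1]
      simp [toC, phi]
    · have h1 := toC_inr (α := α) (Ψ (FreeGroup.of a))
      simp [freeProdEndo, h1]
      simp [toC, phi]
  exact DFunLike.congr_fun this x

theorem phi_inj (Φ : MulAut (FreeGroup α)) (Ψ : MulAut (FreeGroup β)) :
    ∀ i, Function.Injective (phi Φ Ψ i)
  | true => fun x y h => by simpa [phi] using h
  | false => fun x y h => by simpa [phi] using h

theorem phi_iter_true (Φ : MulAut (FreeGroup α)) (Ψ : MulAut (FreeGroup β)) (k : ℕ)
    (x : Fam α β true) : eL ((phi Φ Ψ true)^[k] x) = (Φ ^ k) (eL x) := by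
  induction k with
  | zero => simp
  | succ k ih =>
    rw [Function.iterate_succ_apply', pow_succ', MulAut.mul_apply, ← ih]
    simp [phi]

theorem phi_iter_false (Φ : MulAut (FreeGroup α)) (Ψ : MulAut (FreeGroup β)) (k : ℕ)
    (x : Fam α β false) : eR ((phi Φ Ψ false)^[k] x) = (Ψ ^ k) (eR x) := by
  induction k with
  | zero => simp
  | succ k ih =>
    rw [Function.iterate_succ_apply', pow_succ', MulAut.mul_apply, ← ih]
    simp [phi]

theorem phi_ator (Φ : MulAut (FreeGroup α)) (hΦ : MulAut.Atoroidal Φ)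
    (Ψ : MulAut (FreeGroup β)) (hΨ : MulAut.Atoroidal Ψ) :
    ∀ i (k : ℕ), 1 ≤ k → ∀ x : Fam α β i, x ≠ 1 → ¬ IsConj ((phi Φ Ψ i)^[k] x) x
  | true => fun k hk x hx hc => by
    have := (eL (α := α) (β := β)).toMonoidHom.map_isConj hc
    refine hΦ k hk (eL x) (by simpa using hx) ?_
    rw [← phi_iter_true Φ Ψ k x]
    exact this
  | false => fun k hk x hx hc => by
    have := (eR (α := α) (β := β)).toMonoidHom.map_isConj hc
    refine hΨ k hk (eR x) (by simpa using hx) ?_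
    rw [← phi_iter_false Φ Ψ k x]
    exact this

theorem ator_pow {G : Type*} [Group G] {Φ : MulAut G} (h : MulAut.Atoroidal Φ) {n : ℕ}
    (hn : 1 ≤ n) : MulAut.Atoroidal (Φ ^ n) := by
  intro k hk g hg
  rw [← pow_mul]
  exact h _ (Nat.mul_pos hn hk) g hg

theorem endo_not_conj (Φ : MulAut (FreeGroup α)) (hΦ : MulAut.Atoroidal Φ)
    (Ψ : MulAut (FreeGroup β)) (hΨ : MulAut.Atoroidal Ψ) (g : FreeGroup (α ⊕ β)) (hg : g ≠ 1) :
    ¬ IsConj (freeProdEndo Φ Ψ g) g := by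
  intro hc
  have := toC.map_isConj hc
  rw [toC_endo] at this
  exact main (phi Φ Ψ) (phi_inj Φ Ψ) (phi_ator Φ hΦ Ψ hΨ) (toC g)
    (fun h => hg ((map_eq_one_iff _ toC_inj).1 h)) this

end

end FPAtor

/-- The free product of two atoroidal automorphisms is an automorphism of the free
product and is atoroidal. -/
theorem statement_10 {α β : Type*}
    (Φ : MulAut (FreeGroup α)) (hΦ : MulAut.Atoroidal Φ)
    (Ψ : MulAut (FreeGroup β)) (hΨ : MulAut.Atoroidal Ψ) :
    ∃ Θ : MulAut (FreeGroup (α ⊕ β)),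
      ⇑Θ = ⇑(freeProdEndo Φ Ψ) ∧ MulAut.Atoroidal Θ := by
  let Θ : MulAut (FreeGroup (α ⊕ β)) :=
    MonoidHom.toMulEquiv (freeProdEndo Φ Ψ) (freeProdEndo Φ⁻¹ Ψ⁻¹)
      (by rw [← FPAtor.endo_mul, inv_mul_cancel, inv_mul_cancel, FPAtor.endo_one])
      (by rw [← FPAtor.endo_mul, mul_inv_cancel, mul_inv_cancel, FPAtor.endo_one])
  have hΘ : ⇑Θ = ⇑(freeProdEndo Φ Ψ) := rfl
  refine ⟨Θ, hΘ, ?_⟩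
  intro n hn g hg hc
  refine FPAtor.endo_not_conj (Φ ^ n) (FPAtor.ator_pow hΦ hn) (Ψ ^ n)
    (FPAtor.ator_pow hΨ hn) g hg ?_
  have hp : ∀ k : ℕ, (Θ ^ k) g = Θ^[k] g := by
    intro k
    induction k with
    | zero => rfl
    | succ k ih => rw [pow_succ', MulAut.mul_apply, ih, Function.iterate_succ_apply']
  rw [FPAtor.endo_pow, ← hΘ, ← hp]
  exact hc
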